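/- arXiv:1610.05890 — 7 statements merged into one kernel-verified Lean document; each statement's English description precedes it below -/
import Mathlib

section
/- Let n ≥ 1, let L_i ∈ (0,1) and G_i ∈ (0,1] with L_i ≤ G_i for i = 1,…,n be constants, and let P = (p_{i,j}) ∈ ℝ^{n×n} be a non-negative, strictly upper triangular matrix with Σ_{j=1}^n p_{i,j} ≤ 1 for all i = 1,…,n. Then there exist constants ξ_i > 0 (i = 1,…,n) such that Σ_{j=1}^n p_{j,i} G_j ξ_j < L_i ξ_i for every i = 1,…,n. -/
/-- **Lemma 2.2.** Let `L i ∈ (0,1)`, `G i ∈ (0,1]` with `L i ≤ G i`, and let `P`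
be a non-negative, strictly upper triangular matrix with row sums at most `1`.
Then there exist constants `ξ i > 0` such that
`∑ j, P j i * G j * ξ j < L i * ξ i` for every `i`. -/
theorem stmt1 (n : ℕ) (hn : 1 ≤ n) (L G : Fin n → ℝ)
    (hL : ∀ i, L i ∈ Set.Ioo (0 : ℝ) 1) (hG : ∀ i, G i ∈ Set.Ioc (0 : ℝ) 1)
    (hLG : ∀ i, L i ≤ G i)
    (P : Matrix (Fin n) (Fin n) ℝ)
    (hP_nonneg : ∀ i j, 0 ≤ P i j)
    (hP_sut : ∀ i j : Fin n, (j : ℕ) ≤ (i : ℕ) → P i j = 0)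
    (hP_row : ∀ i, ∑ j, P i j ≤ 1) :
    ∃ ξ : Fin n → ℝ, (∀ i, 0 < ξ i) ∧ ∀ i, ∑ j, P j i * (G j * ξ j) < L i * ξ i := by
  set K : ℝ := 1 + ∑ i, (n : ℝ) / L i with hK
  have hdiv : ∀ i, 0 ≤ (n : ℝ) / L i := fun i => div_nonneg n.cast_nonneg (hL i).1.le
  have hK_one : 1 ≤ K := by
    have := Finset.sum_nonneg fun i (_ : i ∈ Finset.univ) => hdiv i
    linarith
  have hK_pos : 0 < K := by linarith
  have hK_lt : ∀ i, (n : ℝ) < L i * K := by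
    intro i
    have hle := Finset.single_le_sum (fun i _ => hdiv i) (Finset.mem_univ i)
    have hlt : (n : ℝ) / L i < K := by linarith
    rwa [div_lt_iff₀ (hL i).1, mul_comm] at hlt
  refine ⟨fun i => K ^ (i : ℕ), fun i => pow_pos hK_pos _, fun i => ?_⟩
  have hterm : ∀ j, P j i * (G j * K ^ (j : ℕ)) * K ≤ K ^ (i : ℕ) := by
    intro j
    rcases le_or_gt (i : ℕ) (j : ℕ) with hij | hji
    · rw [hP_sut j i hij, zero_mul, zero_mul]
      positivity
    · have hP_le : P j i ≤ 1 :=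
        (Finset.single_le_sum (fun k _ => hP_nonneg j k) (Finset.mem_univ i)).trans (hP_row j)
      have hPG : P j i * G j ≤ 1 := mul_le_one₀ hP_le (hG j).1.le (hG j).2
      calc P j i * (G j * K ^ (j : ℕ)) * K = P j i * G j * K ^ ((j : ℕ) + 1) := by ring
        _ ≤ 1 * K ^ ((j : ℕ) + 1) := by gcongr
        _ = K ^ ((j : ℕ) + 1) := one_mul _
        _ ≤ K ^ (i : ℕ) := pow_le_pow_right₀ hK_one hji
  refine lt_of_mul_lt_mul_right ?_ hK_pos.le
  calc (∑ j, P j i * (G j * K ^ (j : ℕ))) * K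
      = ∑ j, P j i * (G j * K ^ (j : ℕ)) * K := Finset.sum_mul _ _ _
    _ ≤ ∑ _j : Fin n, K ^ (i : ℕ) := Finset.sum_le_sum fun j _ => hterm j
    _ = n * K ^ (i : ℕ) := by simp
    _ < L i * K * K ^ (i : ℕ) := mul_lt_mul_of_pos_right (hK_lt i) (pow_pos hK_pos _)
    _ = L i * K ^ (i : ℕ) * K := by ring
end

section
/- Suppose the demand functions of the network model satisfy assumption (H1). Then for each i = 1,…,n there exists a constant θ_i > 0, namely θ_i := min(L_i, a_i^{-1} f_i^min, a_i^{-1} L_i δ̃_i), such that f_i(d,z) ≥ θ_i z for all d ∈ D and all z ∈ [0,a_i]. -/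
/-- Under assumption (H1) on the demand functions `f i : D × [0, a i] → ℝ₊`
(with `f i d z ≤ z`), for each `i` there is a constant `θ i > 0`, namely
`θ i = min (L i) (min ((a i)⁻¹ * fmin i) ((a i)⁻¹ * (L i * δt i)))`, such that
`f i d z ≥ θ i * z` for all `d ∈ D` and all `z ∈ [0, a i]`. -/
theorem stmt3 (n l : ℕ) (hn : 1 ≤ n)
    (a : Fin n → ℝ) (ha : ∀ i, 0 < a i)
    (D : Set (Fin l → ℝ)) (hD : D.Nonempty) (hD_compact : IsCompact D)
    (f : Fin n → (Fin l → ℝ) → ℝ → ℝ)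
    (hf_nonneg : ∀ i, ∀ d ∈ D, ∀ z ∈ Set.Icc (0 : ℝ) (a i), 0 ≤ f i d z)
    (hf_le : ∀ i, ∀ d ∈ D, ∀ z ∈ Set.Icc (0 : ℝ) (a i), f i d z ≤ z)
    (δ δt L G fmin : Fin n → ℝ)
    -- (H1):
    (hf_pos : ∀ i, ∀ d ∈ D, ∀ z ∈ Set.Ioc (0 : ℝ) (a i), 0 < f i d z ∧ f i d z < z)
    (hδ : ∀ i, δ i ∈ Set.Ioc (0 : ℝ) (a i))
    (hf_cont : ∀ i, ∀ d ∈ D, ContinuousOn (f i d) (Set.Icc 0 (δ i)))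
    (hf_mono : ∀ i, ∀ d ∈ D, StrictMonoOn (f i d) (Set.Icc 0 (δ i)))
    (hL : ∀ i, L i ∈ Set.Ioo (0 : ℝ) 1) (hG : ∀ i, G i ∈ Set.Ioc (0 : ℝ) 1)
    (hδt : ∀ i, δt i ∈ Set.Ioc (0 : ℝ) (δ i))
    (hlip_low : ∀ i, ∀ d ∈ D, ∀ y ∈ Set.Icc (0 : ℝ) (δt i), ∀ z ∈ Set.Icc (0 : ℝ) (δt i),
      L i * |z - y| ≤ |f i d z - f i d y|)
    (hlip_up : ∀ i, ∀ d ∈ D, ∀ y ∈ Set.Icc (0 : ℝ) (δ i), ∀ z ∈ Set.Icc (0 : ℝ) (δ i),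
      |f i d z - f i d y| ≤ G i * |z - y|)
    (hfmin_pos : ∀ i, 0 < fmin i)
    (hfmin : ∀ i, ∀ d ∈ D, ∀ z ∈ Set.Icc (δ i) (a i), fmin i ≤ f i d z) :
    ∀ i : Fin n, ∃ θ : ℝ,
      θ = min (L i) (min ((a i)⁻¹ * fmin i) ((a i)⁻¹ * (L i * δt i))) ∧
      0 < θ ∧ ∀ d ∈ D, ∀ z ∈ Set.Icc (0 : ℝ) (a i), θ * z ≤ f i d z := by
  intro i
  refine ⟨_, rfl, ?_, ?_⟩
  · have := (hL i).1
    have := (hδt i).1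
    have := ha i
    have := hfmin_pos i
    refine lt_min ?_ (lt_min ?_ ?_) <;> positivity
  rintro d hd z ⟨hz, hza⟩
  have hδt0 := (hδt i).1
  have hf0 : f i d 0 = 0 :=
    le_antisymm (hf_le i d hd 0 ⟨le_rfl, (ha i).le⟩) (hf_nonneg i d hd 0 ⟨le_rfl, (ha i).le⟩)
  have hlow : ∀ y ∈ Set.Icc (0 : ℝ) (δt i), L i * y ≤ f i d y := by
    rintro y ⟨hy, hyδ⟩
    have h := hlip_low i d hd 0 ⟨le_rfl, hδt0.le⟩ y ⟨hy, hyδ⟩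
    have hya : y ≤ a i := hyδ.trans ((hδt i).2.trans (hδ i).2)
    rwa [hf0, sub_zero, sub_zero, abs_of_nonneg hy,
      abs_of_nonneg (hf_nonneg i d hd y ⟨hy, hya⟩)] at h
  have hscale : ∀ c : ℝ, 0 ≤ c → (a i)⁻¹ * c * z ≤ c := fun c hc => by
    have h : (a i)⁻¹ * z ≤ 1 := inv_mul_le_one_of_le₀ hza (ha i).le
    nlinarith [mul_le_mul_of_nonneg_left h hc]
  rcases le_total z (δt i) with hzδt | hzδt
  · exact (mul_le_mul_of_nonneg_right (min_le_left _ _) hz).trans (hlow z ⟨hz, hzδt⟩)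
  rcases le_total z (δ i) with hzδ | hzδ
  · calc
      _ ≤ (a i)⁻¹ * (L i * δt i) * z :=
        mul_le_mul_of_nonneg_right ((min_le_right _ _).trans (min_le_right _ _)) hz
      _ ≤ L i * δt i := hscale _ (mul_pos (hL i).1 hδt0).le
      _ ≤ f i d (δt i) := hlow _ ⟨hδt0.le, le_rfl⟩
      _ ≤ f i d z := (hf_mono i d hd).monotoneOn ⟨hδt0.le, (hδt i).2⟩ ⟨hz, hzδ⟩ hzδt
  · calc
      _ ≤ (a i)⁻¹ * fmin i * z :=
        mul_le_mul_of_nonneg_right ((min_le_right _ _).trans (min_le_left _ _)) hz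
      _ ≤ fmin i := hscale _ (hfmin_pos i).le
      _ ≤ f i d z := hfmin i d hd z ⟨hzδ, hza⟩
end

section
/- Let n ≥ 1, let D ⊆ ℝ^l be non-empty and compact, let S = [0,a_1] × … × [0,a_n] with a_i > 0, let v_i^max > 0 and ε̃_i > 0 be constants with ε̃_i < v_i^max for all i, and let V := {v ∈ ℝ₊ⁿ : v_i ≤ v_i^max − ε̃_i for all i}. Let s̃_i : D × S × ℝ₊ⁿ → [0,1] (i = 1,…,n) be continuous functions such that the implication holds: if x_i s̃_i(d,x,v) = 0 for all i and v_i < v_i^max for all i, then x = 0. Then for any constants r_i > 0 (i = 1,…,n) and any ρ₀ > 0, the quantity γ := inf{ Σ_{i=1}^n r_i s̃_i(d,x,v) x_i / Σ_{i=1}^n r_i x_i : (d,x,v) ∈ D × S × V, |x| ≥ ρ₀ } is strictly positive (provided ρ₀ ≤ max_i a_i so that the constraint set is non-empty), and consequently Σ_{i=1}^n r_i s̃_i(d,x,v) x_i ≥ γ Σ_{i=1}^n r_i x_i for all (d,x,v) ∈ D × S × V with |x| ≥ ρ₀. -/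
/-- The state set `S = [0,a₁] × ⋯ × [0,aₙ]`. -/
def stateSet {n : ℕ} (a : Fin n → ℝ) : Set (Fin n → ℝ) :=
  {x | ∀ i, x i ∈ Set.Icc 0 (a i)}

/-- The Euclidean norm of `x ∈ ℝⁿ`. -/
noncomputable def euclNorm {n : ℕ} (x : Fin n → ℝ) : ℝ :=
  Real.sqrt (∑ i, x i ^ 2)

/-- The set of ratios `(∑ i, r i * s̃ i (d,x,v) * x i) / (∑ i, r i * x i)` over all
`(d, x, v) ∈ D × S × V` with `|x| ≥ ρ₀`; the statement asserts its infimum `γ` is positive. -/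
def gammaSet {n l : ℕ} (a : Fin n → ℝ) (D : Set (Fin l → ℝ)) (V : Set (Fin n → ℝ))
    (st : Fin n → (Fin l → ℝ) → (Fin n → ℝ) → (Fin n → ℝ) → ℝ)
    (r : Fin n → ℝ) (ρ₀ : ℝ) : Set ℝ :=
  {γ | ∃ d ∈ D, ∃ x ∈ stateSet a, ∃ v ∈ V, ρ₀ ≤ euclNorm x ∧
    γ = (∑ i, r i * (st i d x v * x i)) / (∑ i, r i * x i)}

theorem isCompact_stateSet {n : ℕ} (a : Fin n → ℝ) : IsCompact (stateSet a) := by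
  convert isCompact_univ_pi (fun i => isCompact_Icc (a := (0 : ℝ)) (b := a i)) using 1
  ext x
  simp only [stateSet, Set.mem_ofPred_eq, Set.mem_univ_pi]

theorem continuous_euclNorm {n : ℕ} : Continuous (euclNorm : (Fin n → ℝ) → ℝ) := by
  unfold euclNorm
  fun_prop

theorem ne_zero_of_euclNorm_pos {n : ℕ} {x : Fin n → ℝ} (h : 0 < euclNorm x) : x ≠ 0 := by
  rintro rfl
  simp [euclNorm] at h

theorem euclNorm_single {n : ℕ} (i : Fin n) (c : ℝ) (hc : 0 ≤ c) :
    euclNorm (Pi.single i c) = c := by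
  have h : ∑ j, (Pi.single i c : Fin n → ℝ) j ^ 2 = c ^ 2 := by
    rw [Finset.sum_eq_single i]
    · simp
    · intro j _ hj
      simp [hj]
    · simp
  rw [euclNorm, h, Real.sqrt_sq hc]

/-- A weighted sum of nonnegative terms with positive weights is positive unless all vanish. -/
theorem weighted_sum_pos {ι : Type*} [Fintype ι] {r y : ι → ℝ} (hr : ∀ i, 0 < r i)
    (hy : ∀ i, 0 ≤ y i) (hne : ¬ ∀ i, y i = 0) : 0 < ∑ i, r i * y i := by
  obtain ⟨i, hi⟩ := not_forall.mp hne
  exact Finset.sum_pos' (fun j _ => mul_nonneg (hr j).le (hy j))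
    ⟨i, Finset.mem_univ i, mul_pos (hr i) (lt_of_le_of_ne (hy i) (Ne.symm hi))⟩

/-- Let `D` be non-empty and compact, `S = ∏ [0, a i]`,
`V = {v ∈ ℝ₊ⁿ : v i ≤ vmax i − εt i}` with `0 < εt i < vmax i`, and let
`s̃ i : D × S × ℝ₊ⁿ → [0,1]` be continuous functions such that
`x i * s̃ i (d,x,v) = 0` for all `i` and `v i < vmax i` for all `i` imply `x = 0`.
Then for any `r i > 0` and any `0 < ρ₀ ≤ max_i a i`, the infimum `γ` of the set of
ratios is strictly positive, and `∑ i, r i * s̃ i (d,x,v) * x i ≥ γ * ∑ i, r i * x i`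
for all `(d,x,v) ∈ D × S × V` with `|x| ≥ ρ₀`. -/
theorem stmt4 (n l : ℕ) (hn : 1 ≤ n)
    (a : Fin n → ℝ) (ha : ∀ i, 0 < a i)
    (D : Set (Fin l → ℝ)) (hD : D.Nonempty) (hD_compact : IsCompact D)
    (vmax εt : Fin n → ℝ) (hεt : ∀ i, 0 < εt i) (hεt' : ∀ i, εt i < vmax i)
    (st : Fin n → (Fin l → ℝ) → (Fin n → ℝ) → (Fin n → ℝ) → ℝ)
    (hst01 : ∀ i, ∀ d ∈ D, ∀ x ∈ stateSet a, ∀ v : Fin n → ℝ, (∀ j, 0 ≤ v j) →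
      st i d x v ∈ Set.Icc (0 : ℝ) 1)
    (hst_cont : ∀ i, ContinuousOn
      (fun q : (Fin l → ℝ) × (Fin n → ℝ) × (Fin n → ℝ) => st i q.1 q.2.1 q.2.2)
      (D ×ˢ stateSet a ×ˢ {v | ∀ j, 0 ≤ v j}))
    (himp : ∀ d ∈ D, ∀ x ∈ stateSet a, ∀ v : Fin n → ℝ, (∀ j, 0 ≤ v j) →
      (∀ i, x i * st i d x v = 0) → (∀ i, v i < vmax i) → x = 0)
    (r : Fin n → ℝ) (hr : ∀ i, 0 < r i)
    (ρ₀ : ℝ) (hρ₀ : 0 < ρ₀) (hρ₀a : ∃ i, ρ₀ ≤ a i) :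
    0 < sInf (gammaSet a D {v | ∀ j, 0 ≤ v j ∧ v j ≤ vmax j - εt j} st r ρ₀) ∧
    ∀ d ∈ D, ∀ x ∈ stateSet a,
      ∀ v ∈ {v : Fin n → ℝ | ∀ j, 0 ≤ v j ∧ v j ≤ vmax j - εt j},
      ρ₀ ≤ euclNorm x →
      sInf (gammaSet a D {v | ∀ j, 0 ≤ v j ∧ v j ≤ vmax j - εt j} st r ρ₀) *
          ∑ i, r i * x i ≤
        ∑ i, r i * (st i d x v * x i) := by
  set V : Set (Fin n → ℝ) := {v | ∀ j, 0 ≤ v j ∧ v j ≤ vmax j - εt j}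
  have hV_compact : IsCompact V := isCompact_stateSet fun j => vmax j - εt j
  set K : Set ((Fin l → ℝ) × (Fin n → ℝ) × (Fin n → ℝ)) :=
    (D ×ˢ stateSet a ×ˢ V) ∩ {q | ρ₀ ≤ euclNorm q.2.1}
  have hK_compact : IsCompact K :=
    (hD_compact.prod ((isCompact_stateSet a).prod hV_compact)).inter_right
      (isClosed_le continuous_const (continuous_euclNorm.comp (by fun_prop)))
  have hden : ∀ x ∈ stateSet a, ρ₀ ≤ euclNorm x → 0 < ∑ i, r i * x i := fun x hx hρ =>
    weighted_sum_pos hr (fun i => (hx i).1) fun h =>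
      ne_zero_of_euclNorm_pos (hρ₀.trans_le hρ) (funext h)
  have hnum : ∀ d ∈ D, ∀ x ∈ stateSet a, ∀ v ∈ V, ρ₀ ≤ euclNorm x →
      0 < ∑ i, r i * (st i d x v * x i) := fun d hd x hx v hv hρ =>
    weighted_sum_pos hr
      (fun i => mul_nonneg (hst01 i d hd x hx v fun j => (hv j).1).1 (hx i).1) fun h =>
        ne_zero_of_euclNorm_pos (hρ₀.trans_le hρ)
          (himp d hd x hx v (fun j => (hv j).1) (fun i => by rw [mul_comm]; exact h i)
            fun i => by linarith [(hv i).2, hεt i])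
  set f : (Fin l → ℝ) × (Fin n → ℝ) × (Fin n → ℝ) → ℝ := fun q =>
    (∑ i, r i * (st i q.1 q.2.1 q.2.2 * q.2.1 i)) / (∑ i, r i * q.2.1 i)
  have hf_cont : ContinuousOn f K := by
    refine ContinuousOn.div (continuousOn_finsetSum _ fun i _ => ?_) (by fun_prop)
      fun q hq => (hden q.2.1 hq.1.2.1 hq.2).ne'
    exact continuousOn_const.mul (((hst_cont i).mono fun q hq =>
      ⟨hq.1.1, hq.1.2.1, fun j => (hq.1.2.2 j).1⟩).mul (by fun_prop))
  have himage : gammaSet a D V st r ρ₀ = f '' K := by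
    ext γ
    constructor
    · rintro ⟨d, hd, x, hx, v, hv, hρ, rfl⟩
      exact ⟨(d, x, v), ⟨⟨hd, hx, hv⟩, hρ⟩, rfl⟩
    · rintro ⟨⟨d, x, v⟩, ⟨⟨hd, hx, hv⟩, hρ⟩, rfl⟩
      exact ⟨d, hd, x, hx, v, hv, hρ, rfl⟩
  have hK_nonempty : K.Nonempty := by
    obtain ⟨d, hd⟩ := hD
    obtain ⟨i, hi⟩ := hρ₀a
    refine ⟨(d, Pi.single i (a i), 0), ⟨hd, fun j => ?_, fun j => ?_⟩, ?_⟩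
    · rcases eq_or_ne j i with rfl | hj
      · simp [(ha j).le]
      · simp [hj, (ha j).le]
    · exact ⟨le_rfl, (sub_pos.mpr (hεt' j)).le⟩
    · exact hi.trans_eq (euclNorm_single i (a i) (ha i).le).symm
  have hcompact : IsCompact (f '' K) := hK_compact.image_of_continuousOn hf_cont
  rw [himage]
  constructor
  · obtain ⟨⟨d, x, v⟩, ⟨⟨hd, hx, hv⟩, hρ⟩, hq⟩ := hcompact.sInf_mem (hK_nonempty.image f)
    rw [← hq]
    exact div_pos (hnum d hd x hx v hv hρ) (hden x hx hρ)
  · intro d hd x hx v hv hρ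
    rw [← le_div_iff₀ (hden x hx hρ)]
    exact csInf_le hcompact.bddBelow ⟨(d, x, v), ⟨⟨hd, hx, hv⟩, hρ⟩, rfl⟩
end

section
/- Consider the uncertain discrete-time network model under assumptions (H1), (H2), (H3). Let r_i > 0 (i = 1,…,n) satisfy r_i > Σ_{j=1}^n r_j p_{i,j} for every i, let ε̃_i ∈ (0, min(v_i^max, min{g_i(d,0) : d ∈ D})) (i = 1,…,n), and let C > 0 be a constant such that Σ_{i=1}^n r_i x_i⁺ ≤ (1−C) Σ_{i=1}^n r_i x_i + Σ_{i=1}^n r_i v_i for all (d,x) ∈ D × S and all v ∈ ℝ₊ⁿ with v_i ≤ min(v_i^max, min{g_i(d,0) : d ∈ D}) − ε̃_i for all i. Then for every ω > 0 and every input sequences {d(t) ∈ D} and {v(t) ∈ ℝ₊ⁿ} with v_i(t) ≤ min(v_i^max, min{g_i(d,0) : d ∈ D}) − ε̃_i for all t ≥ 0 and all i, there exists T > 0 such that every solution x(t) of the network model with arbitrary initial condition x(0) ∈ S satisfies Σ_{i=1}^n r_i x_i(t) ≤ ω + C^{-1} max_{i=1,…,n}(sup{v_i(t) : t ≥ 0})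 Σ_{i=1}^n r_i for all t ≥ T. -/
open Matrix

/-- The map `h(x) = (max(0,x₁),…,max(0,xₙ))'`. -/
def posVec {n : ℕ} (x : Fin n → ℝ) : Fin n → ℝ :=
  fun i => max 0 (x i)

/-- The general uncertain, discrete-time network model (2.9): `n` cells with
capacities `a i`, a non-empty compact disturbance set `D ⊆ ℝˡ`, demand functions
`f`, congestion functions `s`, inflow functions `w`, turning rates `p`, exit
rates `Q` and supply functions `g`, satisfying the standing modelling
assumptions, including (2.7) and (2.8). -/
structure Network (n l : ℕ) where
  /-- storage capacities -/
  a : Fin n → ℝ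
  ha : ∀ i, 0 < a i
  /-- the disturbance set -/
  D : Set (Fin l → ℝ)
  hD : D.Nonempty
  hD_compact : IsCompact D
  /-- demand functions `f i : D × [0, a i] → ℝ₊` -/
  f : Fin n → (Fin l → ℝ) → ℝ → ℝ
  /-- congestion functions `s i : D × S × ℝ₊ⁿ → [0,1]` -/
  s : Fin n → (Fin l → ℝ) → (Fin n → ℝ) → (Fin n → ℝ) → ℝ
  /-- inflow functions `w i : D × S × ℝ₊ⁿ → [0,1]` -/
  w : Fin n → (Fin l → ℝ) → (Fin n → ℝ) → (Fin n → ℝ) → ℝ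
  /-- turning rates -/
  p : Fin n → Fin n → ℝ
  /-- exit rates -/
  Q : Fin n → ℝ
  /-- supply functions `g i : D × S → ℝ₊` -/
  g : Fin n → (Fin l → ℝ) → (Fin n → ℝ) → ℝ
  hf_nonneg : ∀ i, ∀ d ∈ D, ∀ z ∈ Set.Icc (0 : ℝ) (a i), 0 ≤ f i d z
  hf_le : ∀ i, ∀ d ∈ D, ∀ z ∈ Set.Icc (0 : ℝ) (a i), f i d z ≤ z
  hs01 : ∀ i, ∀ d ∈ D, ∀ x ∈ stateSet a, ∀ v : Fin n → ℝ, (∀ j, 0 ≤ v j) →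
    s i d x v ∈ Set.Icc (0 : ℝ) 1
  hw01 : ∀ i, ∀ d ∈ D, ∀ x ∈ stateSet a, ∀ v : Fin n → ℝ, (∀ j, 0 ≤ v j) →
    w i d x v ∈ Set.Icc (0 : ℝ) 1
  hp_nonneg : ∀ i j, 0 ≤ p i j
  hp_diag : ∀ i, p i i = 0
  hQ_nonneg : ∀ i, 0 ≤ Q i
  /-- (2.5): `∑ j, p i j + Q i = 1` -/
  hpQ : ∀ i, (∑ j, p i j) + Q i = 1
  hg_cont : ∀ i, ContinuousOn (fun q : (Fin l → ℝ) × (Fin n → ℝ) => g i q.1 q.2)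
    (D ×ˢ stateSet a)
  hg_nonneg : ∀ i, ∀ d ∈ D, ∀ x ∈ stateSet a, 0 ≤ g i d x
  hg_pos : ∀ i, ∀ d ∈ D, ∀ x ∈ stateSet a, x i < a i →
    0 < g i d x ∧ g i d x ≤ a i - x i
  /-- (2.7): the total inflow of each cell is bounded by its supply -/
  h27 : ∀ i, ∀ d ∈ D, ∀ x ∈ stateSet a, ∀ v : Fin n → ℝ, (∀ j, 0 ≤ v j) →
    w i d x v * v i + ∑ j, p j i * (s j d x v * f j d (x j)) ≤ g i d x
  /-- (2.8): if every attempted total inflow can be accommodated, no congestion -/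
  h28 : ∀ d ∈ D, ∀ x ∈ stateSet a, ∀ v : Fin n → ℝ, (∀ j, 0 ≤ v j) →
    (∀ i, v i + ∑ j, p j i * f j d (x j) ≤ g i d x) →
    ∀ i, w i d x v = 1 ∧ s i d x v = 1

/-- The state update map (2.9):
`x i ⁺ = x i + w i v i − s i f i (x i) + ∑ j, p j i * s j * f j (x j)`. -/
def Network.update {n l : ℕ} (N : Network n l) (d : Fin l → ℝ)
    (x v : Fin n → ℝ) : Fin n → ℝ :=
  fun i => x i + N.w i d x v * v i - N.s i d x v * N.f i d (x i)
    + ∑ j, N.p j i * (N.s j d x v * N.f j d (x j))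

/-- Assumption (H1) on the demand functions. -/
structure H1 {n l : ℕ} (N : Network n l) where
  /-- critical densities -/
  δ : Fin n → ℝ
  δt : Fin n → ℝ
  L : Fin n → ℝ
  G : Fin n → ℝ
  fmin : Fin n → ℝ
  hδ : ∀ i, δ i ∈ Set.Ioc 0 (N.a i)
  hδt : ∀ i, δt i ∈ Set.Ioc 0 (δ i)
  hL : ∀ i, L i ∈ Set.Ioo (0 : ℝ) 1
  hG : ∀ i, G i ∈ Set.Ioc (0 : ℝ) 1
  hf_pos : ∀ i, ∀ d ∈ N.D, ∀ z ∈ Set.Ioc (0 : ℝ) (N.a i),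
    0 < N.f i d z ∧ N.f i d z < z
  hf_cont : ∀ i, ∀ d ∈ N.D, ContinuousOn (N.f i d) (Set.Icc 0 (δ i))
  hf_mono : ∀ i, ∀ d ∈ N.D, StrictMonoOn (N.f i d) (Set.Icc 0 (δ i))
  hlip_low : ∀ i, ∀ d ∈ N.D, ∀ y ∈ Set.Icc (0 : ℝ) (δt i), ∀ z ∈ Set.Icc (0 : ℝ) (δt i),
    L i * |z - y| ≤ |N.f i d z - N.f i d y|
  hlip_up : ∀ i, ∀ d ∈ N.D, ∀ y ∈ Set.Icc (0 : ℝ) (δ i), ∀ z ∈ Set.Icc (0 : ℝ) (δ i),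
    |N.f i d z - N.f i d y| ≤ G i * |z - y|
  hfmin_pos : ∀ i, 0 < fmin i
  hfmin : ∀ i, ∀ d ∈ N.D, ∀ z ∈ Set.Icc (δ i) (N.a i), fmin i ≤ N.f i d z

/-- Assumption (H2): the turning-rate matrix is strictly upper triangular. -/
def Network.H2 {n l : ℕ} (N : Network n l) : Prop :=
  ∀ i j : Fin n, (j : ℕ) ≤ (i : ℕ) → N.p i j = 0

/-- Assumption (H3): continuous positive-definite lower bounds `s̃ i` for the
congestion functions, and constants `vmax i > 0`, such that
`x i * s̃ i (d,x,v) = 0` for all `i` together with `v i < vmax i` for all `i`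
imply `x = 0`. -/
structure H3 {n l : ℕ} (N : Network n l) where
  st : Fin n → (Fin l → ℝ) → (Fin n → ℝ) → (Fin n → ℝ) → ℝ
  vmax : Fin n → ℝ
  hvmax : ∀ i, 0 < vmax i
  hst_cont : ∀ i, ContinuousOn
    (fun q : (Fin l → ℝ) × (Fin n → ℝ) × (Fin n → ℝ) => st i q.1 q.2.1 q.2.2)
    (N.D ×ˢ stateSet N.a ×ˢ {v | ∀ j, 0 ≤ v j})
  hst01 : ∀ i, ∀ d ∈ N.D, ∀ x ∈ stateSet N.a, ∀ v : Fin n → ℝ, (∀ j, 0 ≤ v j) →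
    st i d x v ∈ Set.Icc (0 : ℝ) 1
  hst_le : ∀ i, ∀ d ∈ N.D, ∀ x ∈ stateSet N.a, ∀ v : Fin n → ℝ, (∀ j, 0 ≤ v j) →
    st i d x v ≤ N.s i d x v
  himp : ∀ d ∈ N.D, ∀ x ∈ stateSet N.a, ∀ v : Fin n → ℝ, (∀ j, 0 ≤ v j) →
    (∀ i, x i * st i d x v = 0) → (∀ i, v i < vmax i) → x = 0

/-- Assumption (H4): there exist `μ i ∈ (0, δt i)` such that whenever `x ≤ μ`,
`vmax i + ∑ j, p j i * f j (x j) ≤ g i (d, x)` for every `i`. -/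
structure H4 {n l : ℕ} (N : Network n l) (δt vmax : Fin n → ℝ) where
  μ : Fin n → ℝ
  hμ : ∀ i, μ i ∈ Set.Ioo (0 : ℝ) (δt i)
  hsupply : ∀ i, ∀ d ∈ N.D, ∀ x ∈ stateSet N.a, (∀ j, x j ≤ μ j) →
    vmax i + ∑ j, N.p j i * N.f j d (x j) ≤ N.g i d x

/-- `min { g i (d, 0) : d ∈ D }` (as an infimum). -/
noncomputable def Network.gmin {n l : ℕ} (N : Network n l) (i : Fin n) : ℝ :=
  sInf ((fun d => N.g i d 0) '' N.D)

/-- The feedback law (3.3):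
`v = v* − diag(v* − b) (1ₙ − h(1ₙ − τ⁻¹ K h(x − x*)))`. -/
noncomputable def feedback {n : ℕ} (vstar b : Fin n → ℝ)
    (K : Matrix (Fin n) (Fin n) ℝ) (τ : ℝ) (xstar x : Fin n → ℝ) : Fin n → ℝ :=
  fun i => vstar i - (vstar i - b i) *
    (1 - max 0 (1 - τ⁻¹ * ∑ j, K i j * max 0 (x j - xstar j)))

/-- `x : ℕ → ℝⁿ` is a solution of the closed-loop system (2.9) with (3.3) for the
disturbance sequence `d`. -/
def IsClosedLoopSolution {n l : ℕ} (N : Network n l) (vstar b : Fin n → ℝ)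
    (K : Matrix (Fin n) (Fin n) ℝ) (τ : ℝ) (xstar : Fin n → ℝ)
    (d : ℕ → Fin l → ℝ) (x : ℕ → Fin n → ℝ) : Prop :=
  ∀ t, x (t + 1) = N.update (d t) (x t) (feedback vstar b K τ xstar (x t))

open Filter Topology

/-- By continuity, the supply is bounded by the free capacity on all of the state set. -/
lemma Network.supply_le {n l : ℕ} (N : Network n l) (i : Fin n) {d : Fin l → ℝ}
    (hd : d ∈ N.D) {x : Fin n → ℝ} (hx : x ∈ stateSet N.a) :
    N.g i d x ≤ N.a i - x i := by
  rcases (hx i).2.lt_or_eq with hlt | heq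
  · exact (N.hg_pos i d hd x hx hlt).2
  set y : ℝ → Fin n → ℝ := fun z => Function.update x i z with hy
  have hyS : ∀ z ∈ Set.Ico 0 (N.a i), y z ∈ stateSet N.a := by
    intro z hz j
    rcases eq_or_ne j i with rfl | hj
    · simpa [hy] using ⟨hz.1, hz.2.le⟩
    · simpa [hy, hj] using hx j
  have hyx : y (N.a i) = x := by simp [hy, ← heq]
  have hyt : Tendsto (fun z => (d, y z)) (𝓝[<] N.a i) (𝓝 (d, x)) := by
    have hc : Continuous fun z => (d, y z) := by fun_prop
    simpa [hyx] using (hc.tendsto (N.a i)).mono_left nhdsWithin_le_nhds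
  have hev : ∀ᶠ z in 𝓝[<] N.a i, z ∈ Set.Ico 0 (N.a i) := Ico_mem_nhdsLT (N.ha i)
  have hg : Tendsto (fun z => N.g i d (y z)) (𝓝[<] N.a i) (𝓝 (N.g i d x)) :=
    (N.hg_cont i (d, x) ⟨hd, hx⟩).tendsto.comp
      (tendsto_nhdsWithin_iff.2 ⟨hyt, hev.mono fun z hz => ⟨hd, hyS z hz⟩⟩)
  have hsub : Tendsto (fun z => N.a i - z) (𝓝[<] N.a i) (𝓝 (N.a i - N.a i)) :=
    ((continuous_const.sub continuous_id).tendsto _).mono_left nhdsWithin_le_nhds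
  rw [heq]
  refine le_of_tendsto_of_tendsto hg hsub (hev.mono fun z hz => ?_)
  simpa [hy] using (N.hg_pos i d hd (y z) (hyS z hz) (by simpa [hy] using hz.2)).2

/-- The state set is invariant under the network dynamics. -/
lemma Network.update_mem_stateSet {n l : ℕ} (N : Network n l) {d : Fin l → ℝ}
    (hd : d ∈ N.D) {x v : Fin n → ℝ} (hx : x ∈ stateSet N.a) (hv : ∀ j, 0 ≤ v j) :
    N.update d x v ∈ stateSet N.a := by
  intro i
  have hs := N.hs01 i d hd x hx v hv
  have hf := N.hf_nonneg i d hd (x i) (hx i)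
  have hfx := N.hf_le i d hd (x i) (hx i)
  have hsf : N.s i d x v * N.f i d (x i) ≤ N.f i d (x i) := mul_le_of_le_one_left hf hs.2
  have hsf0 : 0 ≤ N.s i d x v * N.f i d (x i) := mul_nonneg hs.1 hf
  have hwv : 0 ≤ N.w i d x v * v i := mul_nonneg (N.hw01 i d hd x hx v hv).1 (hv i)
  have hin : 0 ≤ ∑ j, N.p j i * (N.s j d x v * N.f j d (x j)) :=
    Finset.sum_nonneg fun j _ => mul_nonneg (N.hp_nonneg j i)
      (mul_nonneg (N.hs01 j d hd x hx v hv).1 (N.hf_nonneg j d hd (x j) (hx j)))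
  have hcap := N.h27 i d hd x hx v hv
  have hg := N.supply_le i hd hx
  unfold Network.update
  constructor <;> linarith

/-- A scalar sequence satisfying an affine contraction inequality is bounded by the
exponentially decaying initial value plus the fixed point of the contraction. -/
lemma affine_contraction_bound {W : ℕ → ℝ} {C B : ℝ} (hC : 0 < C) (hC1 : C ≤ 1)
    (hW : ∀ t, W (t + 1) ≤ (1 - C) * W t + B) (hB : 0 ≤ B) (t : ℕ) :
    W t ≤ (1 - C) ^ t * W 0 + C⁻¹ * B := by
  induction t with
  | zero => simpa using mul_nonneg (inv_nonneg.2 hC.le) hB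
  | succ t ih =>
    calc W (t + 1) ≤ (1 - C) * W t + B := hW t
      _ ≤ (1 - C) * ((1 - C) ^ t * W 0 + C⁻¹ * B) + B := by
        have := mul_le_mul_of_nonneg_left ih (sub_nonneg.2 hC1)
        linarith
      _ = (1 - C) ^ (t + 1) * W 0 + C⁻¹ * B := by field_simp; ring

/-- Under (H1), (H2), (H3), given `r i > 0` with `r i > ∑ j, r j * p i j`,
`εt i ∈ (0, min(vmax i, min{g i (d,0) : d ∈ D}))`, and `C > 0` for which the
contraction estimate (2.14) holds, then for every `ω > 0` and all admissible
input sequences `d(·), v(·)` there is `T > 0` such that every solution of the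
network with arbitrary initial condition `x 0 ∈ S` satisfies
`∑ i, r i * x i (t) ≤ ω + C⁻¹ * max_i (sup_t v i (t)) * ∑ i, r i` for `t ≥ T`. -/
theorem stmt6 {n l : ℕ} (hn : 1 ≤ n) (N : Network n l)
    (h1 : H1 N) (h2 : N.H2) (h3 : H3 N)
    (r : Fin n → ℝ) (hr : ∀ i, 0 < r i)
    (hr' : ∀ i, ∑ j, r j * N.p i j < r i)
    (εt : Fin n → ℝ)
    (hεt : ∀ i, εt i ∈ Set.Ioo 0 (min (h3.vmax i) (N.gmin i)))
    (C : ℝ) (hC : 0 < C)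
    (hC' : ∀ d ∈ N.D, ∀ x ∈ stateSet N.a, ∀ v : Fin n → ℝ,
      (∀ i, 0 ≤ v i ∧ v i ≤ min (h3.vmax i) (N.gmin i) - εt i) →
      ∑ i, r i * N.update d x v i ≤
        (1 - C) * ∑ i, r i * x i + ∑ i, r i * v i) :
    ∀ ω > (0 : ℝ), ∀ d : ℕ → Fin l → ℝ, (∀ t, d t ∈ N.D) →
      ∀ v : ℕ → Fin n → ℝ,
      (∀ t i, 0 ≤ v t i ∧ v t i ≤ min (h3.vmax i) (N.gmin i) - εt i) →
      ∃ T : ℕ, 0 < T ∧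
        ∀ x : ℕ → Fin n → ℝ, x 0 ∈ stateSet N.a →
        (∀ t, x (t + 1) = N.update (d t) (x t) (v t)) →
        ∀ t ≥ T, ∑ i, r i * x t i ≤
          ω + C⁻¹ * (⨆ t' : ℕ, ⨆ i : Fin n, v t' i) * ∑ i, r i := by
  intro ω hω d hd v hv
  have : Nonempty (Fin n) := ⟨⟨0, hn⟩⟩
  set A := ∑ i, r i * N.a i
  set M := ⨆ t' : ℕ, ⨆ i : Fin n, v t' i
  have hApos : 0 < A :=
    Finset.sum_pos (fun i _ => mul_pos (hr i) (N.ha i)) Finset.univ_nonempty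
  have hC1 : C ≤ 1 := by
    have ha : N.a ∈ stateSet N.a := fun i => ⟨(N.ha i).le, le_rfl⟩
    have hstep := hC' (d 0) (hd 0) N.a ha 0 fun i => ⟨le_rfl, sub_nonneg.2 (hεt i).2.le⟩
    have hnonneg : 0 ≤ ∑ i, r i * N.update (d 0) N.a 0 i :=
      Finset.sum_nonneg fun i _ => mul_nonneg (hr i).le
        (N.update_mem_stateSet (hd 0) ha (fun _ => le_rfl) i).1
    simp only [Pi.zero_apply, mul_zero, Finset.sum_const_zero, add_zero] at hstep
    by_contra! h
    nlinarith
  have hbdd : BddAbove (Set.range fun t' => ⨆ i, v t' i) := by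
    refine ⟨⨆ i, (min (h3.vmax i) (N.gmin i) - εt i), ?_⟩
    rintro _ ⟨t, rfl⟩
    exact ciSup_mono (Set.finite_range _).bddAbove fun i => (hv t i).2
  have hvM : ∀ t i, v t i ≤ M := fun t i =>
    (le_ciSup (Set.finite_range (v t)).bddAbove i).trans (le_ciSup hbdd t)
  have hM0 : 0 ≤ M := (hv 0 ⟨0, hn⟩).1.trans (hvM 0 _)
  have hB : 0 ≤ M * ∑ i, r i := mul_nonneg hM0 (Finset.sum_nonneg fun i _ => (hr i).le)
  have hlim : Tendsto (fun t : ℕ => (1 - C) ^ t * A) atTop (𝓝 0) := by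
    simpa using (tendsto_pow_atTop_nhds_zero_of_lt_one (sub_nonneg.2 hC1)
      (sub_lt_self 1 hC)).mul_const A
  obtain ⟨T, hT⟩ := eventually_atTop.1 (hlim.eventually_le_const hω)
  refine ⟨T + 1, T.succ_pos, fun x hx0 hx t ht => ?_⟩
  have hxS : ∀ t, x t ∈ stateSet N.a := by
    intro t
    induction t with
    | zero => exact hx0
    | succ t ih => exact hx t ▸ N.update_mem_stateSet (hd t) ih fun j => (hv t j).1
  have hbound := affine_contraction_bound (W := fun t => ∑ i, r i * x t i)
    (B := M * ∑ i, r i) hC hC1 (fun t => ?_) hB t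
  · have hW0 : ∑ i, r i * x 0 i ≤ A :=
      Finset.sum_le_sum fun i _ => mul_le_mul_of_nonneg_left (hx0 i).2 (hr i).le
    have hdecay := mul_le_mul_of_nonneg_left hW0 (pow_nonneg (sub_nonneg.2 hC1) t)
    have hω' := hT t (by omega)
    rw [mul_assoc]
    linarith
  · have hstep := hC' (d t) (hd t) (x t) (hxS t) (v t) (hv t)
    have hin : ∑ i, r i * v t i ≤ M * ∑ i, r i := by
      rw [Finset.mul_sum]
      exact Finset.sum_le_sum fun i _ =>
        (mul_le_mul_of_nonneg_left (hvM t i) (hr i).le).trans_eq (mul_comm _ _)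
    simp only [hx t]
    linarith
end

section
/- Consider the uncertain discrete-time network model under assumptions (H1), (H2), (H3), (H4). Assume the existence of a point x* ∈ S with x_i* ∈ (0,μ_i) for all i and a vector v* ∈ ℝ₊ⁿ with v_i* < v_i^max for all i, satisfying f_i(d,x_i*) = v_i* + Σ_{j=1}^n p_{j,i} f_j(d,x_j*) for all i and all d ∈ D. Then there exist constants β_i ∈ (x_i*, μ_i] (i = 1,…,n) such that for every b ∈ ℝ₊ⁿ with b ≤ v*, every non-negative matrix K ∈ ℝ₊^{n×n} and every τ > 0, the set Ω = [0,β_1] × … × [0,β_n] is positively invariant for the closed-loop system, i.e., x ∈ Ω and d ∈ D imply x⁺ ∈ Ω, where x⁺ is the network update with the inflow v given by the feedback law (3.3). -/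
open Matrix

/-- For a strictly upper triangular matrix with entries in `[0,1]`, there are arbitrarily small
positive weights `γ` which the transposed matrix maps below `L * γ`. -/
theorem exists_pos_weights {n : ℕ} (p : Fin n → Fin n → ℝ) (L r : Fin n → ℝ)
    (hp1 : ∀ i j, p i j ≤ 1)
    (hp : ∀ i j : Fin n, (j : ℕ) ≤ (i : ℕ) → p i j = 0)
    (hL : ∀ i, 0 < L i) (hr : ∀ i, 0 < r i) :
    ∃ γ : Fin n → ℝ, (∀ i, 0 < γ i ∧ γ i ≤ r i) ∧ ∀ i, ∑ j, p j i * γ j ≤ L i * γ i := by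
  obtain ⟨M, hM1, hM⟩ : ∃ M : ℝ, 1 ≤ M ∧ ∀ i, (n : ℝ) / L i ≤ M :=
    ((Filter.eventually_ge_atTop 1).and
      (Filter.eventually_all.2 fun i => Filter.eventually_ge_atTop _)).exists
  have hM0 : 0 < M := by linarith
  obtain ⟨ε, hε, hεr⟩ : ∃ ε : ℝ, 0 < ε ∧ ∀ i : Fin n, ε ≤ r i / M ^ (i : ℕ) := by
    have h : ∀ᶠ ε in nhdsWithin (0 : ℝ) (Set.Ioi 0), ∀ i : Fin n, ε ≤ r i / M ^ (i : ℕ) :=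
      Filter.eventually_all.2 fun i => Filter.Eventually.filter_mono nhdsWithin_le_nhds
        (eventually_le_nhds (div_pos (hr i) (pow_pos hM0 _)))
    obtain ⟨ε, hε, h⟩ := (eventually_mem_nhdsWithin.and h).exists
    exact ⟨ε, hε, h⟩
  refine ⟨fun i => ε * M ^ (i : ℕ), fun i => ⟨by positivity, ?_⟩, fun i => ?_⟩
  · exact (le_div_iff₀ (pow_pos hM0 _)).1 (hεr i)
  have hn : (0 : ℝ) < n := by exact_mod_cast i.pos
  have hLM : (n : ℝ) ≤ L i * M := by
    have := (div_le_iff₀ (hL i)).1 (hM i)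
    linarith
  have hterm : ∀ j, p j i * (ε * M ^ (j : ℕ)) ≤ L i * (ε * M ^ (i : ℕ)) / n := by
    intro j
    have := hL i
    by_cases hij : (i : ℕ) ≤ (j : ℕ)
    · rw [hp j i hij, zero_mul]
      positivity
    · rw [le_div_iff₀ hn]
      have hpow : M ^ (j : ℕ) * M ≤ M ^ (i : ℕ) := by
        rw [← pow_succ]
        exact pow_le_pow_right₀ hM1 (by omega)
      calc p j i * (ε * M ^ (j : ℕ)) * n ≤ 1 * (ε * M ^ (j : ℕ)) * (L i * M) := by
            gcongr
            exact hp1 j i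
        _ = L i * (ε * (M ^ (j : ℕ) * M)) := by ring
        _ ≤ L i * (ε * M ^ (i : ℕ)) := by gcongr
  calc ∑ j, p j i * (ε * M ^ (j : ℕ)) ≤ ∑ _j : Fin n, L i * (ε * M ^ (i : ℕ)) / n :=
        Finset.sum_le_sum fun j _ => hterm j
    _ = L i * (ε * M ^ (i : ℕ)) := by
        rw [Finset.sum_const, Finset.card_univ, Fintype.card_fin, nsmul_eq_mul]
        field_simp

theorem Network.p_le_one {n l : ℕ} (N : Network n l) (i j : Fin n) : N.p i j ≤ 1 := by
  have := Finset.single_le_sum (fun k _ => N.hp_nonneg i k) (Finset.mem_univ j)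
  linarith [N.hpQ i, N.hQ_nonneg i]

/-- The feedback law takes its values between `b` and `v*`. -/
theorem feedback_mem_Icc {n : ℕ} {vstar b : Fin n → ℝ} {K : Matrix (Fin n) (Fin n) ℝ} {τ : ℝ}
    (hb : ∀ i, b i ≤ vstar i) (hK : ∀ i j, 0 ≤ K i j) (hτ : 0 < τ) (xstar x : Fin n → ℝ)
    (i : Fin n) : feedback vstar b K τ xstar x i ∈ Set.Icc (b i) (vstar i) := by
  have hsum : 0 ≤ τ⁻¹ * ∑ j, K i j * max 0 (x j - xstar j) :=
    mul_nonneg (inv_nonneg.2 hτ.le)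
      (Finset.sum_nonneg fun j _ => mul_nonneg (hK i j) (le_max_left _ _))
  unfold feedback
  set t := max 0 (1 - τ⁻¹ * ∑ j, K i j * max 0 (x j - xstar j))
  have ht0 : 0 ≤ t := le_max_left _ _
  have ht1 : t ≤ 1 := max_le zero_le_one (by linarith)
  have hbi := hb i
  constructor <;> nlinarith

/-- Below the thresholds of (H4) no congestion occurs for inflows below `vmax`. -/
theorem Network.update_eq_of_le {n l : ℕ} (N : Network n l) {δt vmax : Fin n → ℝ}
    (h4 : H4 N δt vmax) {d : Fin l → ℝ} (hd : d ∈ N.D) {x v : Fin n → ℝ}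
    (hx : x ∈ stateSet N.a) (hxμ : ∀ i, x i ≤ h4.μ i) (hv0 : ∀ i, 0 ≤ v i)
    (hv : ∀ i, v i ≤ vmax i) (i : Fin n) :
    N.update d x v i = x i + v i - N.f i d (x i) + ∑ j, N.p j i * N.f j d (x j) := by
  have hws := N.h28 d hd x hx v hv0 fun i =>
    (add_le_add_left (hv i) _).trans (h4.hsupply i d hd x hx hxμ)
  simp [Network.update, hws]

/-- **Proposition 3.3.** Under (H1), (H2), (H3), (H4), assume the existence of an
uncongested equilibrium point `x*` with `x* i ∈ (0, μ i)` and `v* i ∈ [0, vmax i)`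
satisfying (3.1). Then there exist constants `β i ∈ (x* i, μ i]` such that for
every `b ∈ ℝ₊ⁿ` with `b ≤ v*`, every non-negative matrix `K` and every `τ > 0`,
the set `Ω = [0,β₁] × ⋯ × [0,βₙ]` is positively invariant for the closed-loop
system: `x ∈ Ω` and `d ∈ D` imply `x⁺ ∈ Ω`. -/
theorem stmt8 {n l : ℕ} (hn : 1 ≤ n) (N : Network n l)
    (h1 : H1 N) (h2 : N.H2) (h3 : H3 N) (h4 : H4 N h1.δt h3.vmax)
    (xstar vstar : Fin n → ℝ)
    (hxstar : ∀ i, xstar i ∈ Set.Ioo 0 (h4.μ i))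
    (hvstar_nonneg : ∀ i, 0 ≤ vstar i)
    (hvstar : ∀ i, vstar i < h3.vmax i)
    (heq : ∀ d ∈ N.D, ∀ i,
      N.f i d (xstar i) = vstar i + ∑ j, N.p j i * N.f j d (xstar j)) :
    ∃ β : Fin n → ℝ, (∀ i, β i ∈ Set.Ioc (xstar i) (h4.μ i)) ∧
      ∀ b : Fin n → ℝ, (∀ i, 0 ≤ b i) → (∀ i, b i ≤ vstar i) →
      ∀ K : Matrix (Fin n) (Fin n) ℝ, (∀ i j, 0 ≤ K i j) →
      ∀ τ : ℝ, 0 < τ →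
      ∀ d ∈ N.D, ∀ x : Fin n → ℝ, (∀ i, x i ∈ Set.Icc 0 (β i)) →
      ∀ i, N.update d x (feedback vstar b K τ xstar x) i ∈ Set.Icc 0 (β i) := by
  have hδ : ∀ i, h4.μ i < h1.δt i ∧ h1.δt i ≤ h1.δ i ∧ h1.δ i ≤ N.a i := fun i =>
    ⟨(h4.hμ i).2, (h1.hδt i).2, (h1.hδ i).2⟩
  obtain ⟨γ, hγ, hγsum⟩ := exists_pos_weights N.p h1.L (fun i => h4.μ i - xstar i)
    N.p_le_one h2 (fun i => (h1.hL i).1) (fun i => sub_pos.2 (hxstar i).2)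
  refine ⟨fun i => xstar i + γ i, fun i => ⟨by linarith [(hγ i).1], by linarith [(hγ i).2]⟩, ?_⟩
  intro b hb0 hb K hK τ hτ d hd x hx i
  have hv := feedback_mem_Icc hb hK hτ xstar x
  have hβμ : ∀ i, xstar i + γ i ≤ h4.μ i := fun i => by linarith [(hγ i).2]
  have hxμ : ∀ i, x i ≤ h4.μ i := fun i => (hx i).2.trans (hβμ i)
  have hxS : x ∈ stateSet N.a := fun i =>
    ⟨(hx i).1, by linarith [hxμ i, hδ i]⟩
  rw [N.update_eq_of_le h4 hd hxS hxμ (fun i => (hb0 i).trans (hv i).1)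
    (fun i => (hv i).2.trans (hvstar i).le)]
  have hxδ : ∀ i, x i ∈ Set.Icc 0 (h1.δ i) := fun i =>
    ⟨(hx i).1, by linarith [hxμ i, hδ i]⟩
  have hβδt : ∀ i, xstar i + γ i ∈ Set.Icc 0 (h1.δt i) := fun i =>
    ⟨by linarith [(hxstar i).1, (hγ i).1], by linarith [hβμ i, hδ i]⟩
  have hsδt : ∀ i, xstar i ∈ Set.Icc 0 (h1.δt i) := fun i =>
    ⟨(hxstar i).1.le, by linarith [(hxstar i).2, hδ i]⟩
  have hsub : ∀ i, Set.Icc 0 (h1.δt i) ⊆ Set.Icc 0 (h1.δ i) := fun i =>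
    Set.Icc_subset_Icc_right (hδ i).2.1
  have hlip : ∀ j, ∀ y ∈ Set.Icc 0 (h1.δ j), ∀ z ∈ Set.Icc 0 (h1.δ j), y ≤ z →
      N.f j d z - N.f j d y ≤ z - y := by
    intro j y hy z hz hyz
    calc N.f j d z - N.f j d y ≤ |N.f j d z - N.f j d y| := le_abs_self _
      _ ≤ h1.G j * |z - y| := h1.hlip_up j d hd y hy z hz
      _ ≤ 1 * |z - y| := by
          gcongr
          exact (h1.hG j).2
      _ = z - y := by rw [one_mul, abs_of_nonneg (sub_nonneg.2 hyz)]
  constructor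
  · have hsum : 0 ≤ ∑ j, N.p j i * N.f j d (x j) :=
      Finset.sum_nonneg fun j _ => mul_nonneg (N.hp_nonneg j i) (N.hf_nonneg j d hd _ (hxS j))
    linarith [N.hf_le i d hd _ (hxS i), hb0 i, (hv i).1]
  · have hself := hlip i _ (hxδ i) _ (hsub i (hβδt i)) (hx i).2
    have hsum : ∑ j, N.p j i * N.f j d (x j) ≤
        ∑ j, N.p j i * N.f j d (xstar j) + ∑ j, N.p j i * γ j := by
      rw [← Finset.sum_add_distrib]
      refine Finset.sum_le_sum fun j _ => ?_
      rw [← mul_add]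
      refine mul_le_mul_of_nonneg_left ?_ (N.hp_nonneg j i)
      have hmono := (h1.hf_mono j d hd).monotoneOn (hxδ j) (hsub j (hβδt j)) (hx j).2
      have := hlip j _ (hsub j (hsδt j)) _ (hsub j (hβδt j)) (by linarith [(hγ j).1])
      linarith
    have hlow := h1.hlip_low i d hd _ (hsδt i) _ (hβδt i)
    have hmono := (h1.hf_mono i d hd).monotoneOn (hsub i (hsδt i)) (hsub i (hβδt i))
      (by linarith [(hγ i).1])
    rw [abs_of_nonneg (sub_nonneg.2 hmono), add_sub_cancel_left,
      abs_of_pos (hγ i).1] at hlow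
    linarith [heq d hd i, hγsum i, (hv i).2]
end

section
/- Consider the uncertain discrete-time network model under assumptions (H1), (H2), (H3), (H4). Assume the existence of a point x* ∈ S with x_i* ∈ (0,μ_i) for all i and a vector v* ∈ ℝ₊ⁿ with v_i* < v_i^max for all i, satisfying f_i(d,x_i*) = v_i* + Σ_{j=1}^n p_{j,i} f_j(d,x_j*) for all i and all d ∈ D. Then there exist constants β_i ∈ (x_i*, μ_i] (i = 1,…,n) such that for every b ∈ ℝ₊ⁿ with b ≤ v*, every non-negative matrix K ∈ ℝ₊^{n×n} and every τ > 0, the set Ω = [0,β_1] × … × [0,β_n] satisfies: (i) x ∈ Ω and d ∈ D imply x⁺ ∈ Ω; (ii) x ∈ Ω and d ∈ D imply h(x⁺ − x*) ≤ (I + P' diag(G) − diag(L)) h(x − x*); and (iii) x ∈ Ω and d ∈ D imply h(x* − x⁺) ≤ (I + P' diag(G) − diag(L)) h(x* − x) + diag(v* − b) τ^{-1} K h(x − x*), where x⁺ is the network update with the inflow v given by the feedback law (3.3), L = (L_1,…,L_n)', G = (G_1,…,G_n)', and P' is the transpose of the turning-rate matrix P = (p_{i,j}). -/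
open Matrix

/-- A system of inequalities `∑ j, M j i * e j ≤ L i * e i` with `M` strictly upper triangular has
positive solutions `e` below any prescribed positive bound. -/
lemma exists_pos_le_sum_mul_le {n : ℕ} (M : Fin n → Fin n → ℝ) (L r : Fin n → ℝ)
    (hM_le : ∀ i j, M i j ≤ 1)
    (hM : ∀ i j : Fin n, (j : ℕ) ≤ (i : ℕ) → M i j = 0)
    (hL : ∀ i, 0 < L i) (hr : ∀ i, 0 < r i) :
    ∃ e : Fin n → ℝ, (∀ i, 0 < e i) ∧ (∀ i, e i ≤ r i) ∧
      ∀ i, ∑ j, M j i * e j ≤ L i * e i := by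
  rcases isEmpty_or_nonempty (Fin n) with hE | hE
  · exact ⟨fun _ => 1, fun i => hE.elim i, fun i => hE.elim i, fun i => hE.elim i⟩
  obtain ⟨i₀, hi₀⟩ := Finite.exists_max fun i => (n : ℝ) / L i
  set c : ℝ := max 1 (n / L i₀)
  have hc1 : 1 ≤ c := le_max_left _ _
  have hc : ∀ i, (n : ℝ) ≤ L i * c := fun i => by
    have h : (n : ℝ) / L i ≤ c := (hi₀ i).trans (le_max_right _ _)
    rwa [div_le_iff₀' (hL i)] at h
  have hpow : ∀ k : ℕ, 0 < c ^ k := fun k => pow_pos (by linarith) k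
  obtain ⟨i₁, hi₁⟩ := Finite.exists_min fun i => r i / c ^ (i : ℕ)
  set ε : ℝ := r i₁ / c ^ (i₁ : ℕ)
  have hε : 0 < ε := div_pos (hr i₁) (hpow _)
  refine ⟨fun i => ε * c ^ (i : ℕ), fun i => mul_pos hε (hpow _), fun i => ?_, fun i => ?_⟩
  · exact (le_div_iff₀ (hpow _)).1 (hi₁ i)
  · have hterm : ∀ j : Fin n, M j i * (ε * c ^ (j : ℕ)) * c ≤ ε * c ^ (i : ℕ) := fun j => by
      rcases le_or_gt (i : ℕ) (j : ℕ) with hij | hij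
      · rw [hM j i hij]
        simpa using (mul_pos hε (hpow i)).le
      · have h : c ^ ((j : ℕ) + 1) ≤ c ^ (i : ℕ) := pow_le_pow_right₀ hc1 hij
        calc M j i * (ε * c ^ (j : ℕ)) * c = M j i * (ε * c ^ ((j : ℕ) + 1)) := by ring
          _ ≤ 1 * (ε * c ^ ((j : ℕ) + 1)) :=
              mul_le_mul_of_nonneg_right (hM_le j i) (mul_pos hε (hpow _)).le
          _ ≤ ε * c ^ (i : ℕ) := by
              rw [one_mul]
              exact mul_le_mul_of_nonneg_left h hε.le
    have hsum : (∑ j, M j i * (ε * c ^ (j : ℕ))) * c ≤ L i * (ε * c ^ (i : ℕ)) * c := by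
      calc (∑ j, M j i * (ε * c ^ (j : ℕ))) * c
          ≤ ∑ _j : Fin n, ε * c ^ (i : ℕ) := by
            rw [Finset.sum_mul]
            exact Finset.sum_le_sum fun j _ => hterm j
        _ = n * (ε * c ^ (i : ℕ)) := by simp
        _ ≤ L i * c * (ε * c ^ (i : ℕ)) :=
            mul_le_mul_of_nonneg_right (hc i) (mul_pos hε (hpow _)).le
        _ = L i * (ε * c ^ (i : ℕ)) * c := by ring
    exact le_of_mul_le_mul_right hsum (by linarith)

/-- Positive-part form of the upper Lipschitz bound of an increasing demand function. -/
lemma H1.sub_le_mul_max {n l : ℕ} {N : Network n l} (h1 : H1 N) {i : Fin n} {d : Fin l → ℝ}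
    (hd : d ∈ N.D) {y z : ℝ} (hy : y ∈ Set.Icc 0 (h1.δ i)) (hz : z ∈ Set.Icc 0 (h1.δ i)) :
    N.f i d z - N.f i d y ≤ h1.G i * max 0 (z - y) := by
  rcases le_total z y with h | h
  · rw [max_eq_left (by linarith), mul_zero, sub_nonpos]
    exact (h1.hf_mono i d hd).monotoneOn hz hy h
  · have := h1.hlip_up i d hd y hy z hz
    rw [abs_of_nonneg (sub_nonneg.2 h)] at this
    rw [max_eq_right (by linarith)]
    exact (le_abs_self _).trans this

/-- The map `z ↦ z - f z` contracts positive parts near the origin. -/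
lemma H1.sub_sub_sub_le_mul_max {n l : ℕ} {N : Network n l} (h1 : H1 N) {i : Fin n}
    {d : Fin l → ℝ} (hd : d ∈ N.D) {y z : ℝ} (hy : y ∈ Set.Icc 0 (h1.δt i))
    (hz : z ∈ Set.Icc 0 (h1.δt i)) :
    z - y - (N.f i d z - N.f i d y) ≤ (1 - h1.L i) * max 0 (z - y) := by
  have hsub : Set.Icc 0 (h1.δt i) ⊆ Set.Icc 0 (h1.δ i) :=
    Set.Icc_subset_Icc_right (h1.hδt i).2
  rcases le_total z y with h | h
  · have hG := h1.sub_le_mul_max hd (hsub hz) (hsub hy)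
    rw [max_eq_right (by linarith)] at hG
    rw [max_eq_left (by linarith), mul_zero]
    have := mul_le_mul_of_nonneg_right (h1.hG i).2 (sub_nonneg.2 h)
    linarith
  · have hLip := h1.hlip_low i d hd y hy z hz
    have hmono := (h1.hf_mono i d hd).monotoneOn (hsub hy) (hsub hz) h
    rw [abs_of_nonneg (sub_nonneg.2 h), abs_of_nonneg (sub_nonneg.2 hmono)] at hLip
    rw [max_eq_right (by linarith)]
    linarith

/-- The feedback law takes values between `b` and `vstar`, with an explicit lower bound. -/
lemma feedback_bounds {n : ℕ} {vstar b : Fin n → ℝ} {K : Matrix (Fin n) (Fin n) ℝ} {τ : ℝ}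
    (xstar x : Fin n → ℝ) (hb : ∀ i, b i ≤ vstar i) (hK : ∀ i j, 0 ≤ K i j) (hτ : 0 < τ)
    (i : Fin n) :
    b i ≤ feedback vstar b K τ xstar x i ∧ feedback vstar b K τ xstar x i ≤ vstar i ∧
      vstar i - feedback vstar b K τ xstar x i ≤
        (vstar i - b i) * (τ⁻¹ * ∑ j, K i j * max 0 (x j - xstar j)) := by
  have ht : 0 ≤ τ⁻¹ * ∑ j, K i j * max 0 (x j - xstar j) :=
    mul_nonneg (inv_nonneg.2 hτ.le)
      (Finset.sum_nonneg fun j _ => mul_nonneg (hK i j) (le_max_left _ _))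
  simp only [feedback]
  generalize τ⁻¹ * ∑ j, K i j * max 0 (x j - xstar j) = t at ht
  have hvb : 0 ≤ vstar i - b i := sub_nonneg.2 (hb i)
  have h0 : 0 ≤ 1 - max 0 (1 - t) := by
    rw [sub_nonneg]; exact max_le zero_le_one (by linarith)
  have hle1 : 1 - max 0 (1 - t) ≤ 1 := by linarith [le_max_left 0 (1 - t)]
  have hlet : 1 - max 0 (1 - t) ≤ t := by linarith [le_max_right 0 (1 - t)]
  have e0 := mul_nonneg hvb h0
  have e1 := mul_le_mul_of_nonneg_left hle1 hvb
  have e2 := mul_le_mul_of_nonneg_left hlet hvb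
  refine ⟨?_, ?_, ?_⟩ <;> linarith

/-- Below the congestion threshold the update is free-flow. -/
lemma H4.update_eq {n l : ℕ} {N : Network n l} {δt vmax : Fin n → ℝ} (h4 : H4 N δt vmax)
    {d : Fin l → ℝ} (hd : d ∈ N.D) {x v : Fin n → ℝ} (hxS : x ∈ stateSet N.a)
    (hx : ∀ j, x j ≤ h4.μ j) (hv0 : ∀ j, 0 ≤ v j) (hv : ∀ j, v j ≤ vmax j) (i : Fin n) :
    N.update d x v i = x i + v i - N.f i d (x i) + ∑ j, N.p j i * N.f j d (x j) := by
  have hone := N.h28 d hd x hxS v hv0 fun i => by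
    linarith [h4.hsupply i d hd x hxS hx, hv i]
  simp [Network.update, (hone _).1, (hone _).2]

lemma one_add_transpose_mul_diagonal_sub_diagonal_mulVec {n : ℕ} (p : Fin n → Fin n → ℝ)
    (G L y : Fin n → ℝ) (i : Fin n) :
    ((1 : Matrix (Fin n) (Fin n) ℝ) + (Matrix.of p)ᵀ * Matrix.diagonal G
      - Matrix.diagonal L).mulVec y i = (1 - L i) * y i + ∑ j, p j i * (G j * y j) := by
  rw [Matrix.sub_mulVec, Matrix.add_mulVec, Matrix.one_mulVec, ← Matrix.mulVec_mulVec]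
  simp only [Pi.sub_apply, Pi.add_apply, Matrix.mulVec_diagonal]
  simp only [Matrix.mulVec, dotProduct, Matrix.transpose_apply, Matrix.of_apply,
    Matrix.diagonal_apply, ite_mul, zero_mul, Finset.sum_ite_eq, Finset.mem_univ, if_true]
  ring

/-- **Lemma 3.4.** Under (H1), (H2), (H3), (H4), assume the existence of an
uncongested equilibrium point `x*` with `x* i ∈ (0, μ i)` and `v* i ∈ [0, vmax i)`
satisfying (3.1). Then there exist constants `β i ∈ (x* i, μ i]` such that for
every `b ∈ ℝ₊ⁿ` with `b ≤ v*`, every non-negative matrix `K` and every `τ > 0`,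
the set `Ω = [0,β₁] × ⋯ × [0,βₙ]` satisfies (3.5) (positive invariance), (3.6)
`h(x⁺ − x*) ≤ (I + Pᵀ diag(G) − diag(L)) h(x − x*)`, and (3.7)
`h(x* − x⁺) ≤ (I + Pᵀ diag(G) − diag(L)) h(x* − x) + diag(v* − b) τ⁻¹ K h(x − x*)`,
where `x⁺` is the closed-loop update of `x` under the feedback law (3.3). -/
theorem stmt9 {n l : ℕ} (hn : 1 ≤ n) (N : Network n l)
    (h1 : H1 N) (h2 : N.H2) (h3 : H3 N) (h4 : H4 N h1.δt h3.vmax)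
    (xstar vstar : Fin n → ℝ)
    (hxstar : ∀ i, xstar i ∈ Set.Ioo 0 (h4.μ i))
    (hvstar_nonneg : ∀ i, 0 ≤ vstar i)
    (hvstar : ∀ i, vstar i < h3.vmax i)
    (heq : ∀ d ∈ N.D, ∀ i,
      N.f i d (xstar i) = vstar i + ∑ j, N.p j i * N.f j d (xstar j)) :
    ∃ β : Fin n → ℝ, (∀ i, β i ∈ Set.Ioc (xstar i) (h4.μ i)) ∧
      ∀ b : Fin n → ℝ, (∀ i, 0 ≤ b i) → (∀ i, b i ≤ vstar i) →
      ∀ K : Matrix (Fin n) (Fin n) ℝ, (∀ i j, 0 ≤ K i j) →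
      ∀ τ : ℝ, 0 < τ →
      ∀ d ∈ N.D, ∀ x : Fin n → ℝ, (∀ i, x i ∈ Set.Icc 0 (β i)) →
      let A : Matrix (Fin n) (Fin n) ℝ :=
        (1 : Matrix (Fin n) (Fin n) ℝ) + (Matrix.of N.p)ᵀ * Matrix.diagonal h1.G
          - Matrix.diagonal h1.L
      let xp : Fin n → ℝ := N.update d x (feedback vstar b K τ xstar x)
      (∀ i, xp i ∈ Set.Icc 0 (β i)) ∧
      (∀ i, posVec (xp - xstar) i ≤ A.mulVec (posVec (x - xstar)) i) ∧
      (∀ i, posVec (xstar - xp) i ≤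
        A.mulVec (posVec (xstar - x)) i +
          (Matrix.diagonal (vstar - b) * (τ⁻¹ • K)).mulVec (posVec (x - xstar)) i) := by
  have hp1 : ∀ i j, N.p i j ≤ 1 := fun i j => by
    linarith [Finset.single_le_sum (fun k _ => N.hp_nonneg i k) (Finset.mem_univ j),
      N.hpQ i, N.hQ_nonneg i]
  obtain ⟨e, he0, her, hesum⟩ := exists_pos_le_sum_mul_le (fun j i => N.p j i * h1.G j) h1.L
    (fun i => h4.μ i - xstar i)
    (fun i j => mul_le_one₀ (hp1 i j) (h1.hG i).1.le (h1.hG i).2)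
    (fun i j hij => by rw [h2 i j hij, zero_mul]) (fun i => (h1.hL i).1)
    (fun i => sub_pos.2 (hxstar i).2)
  refine ⟨fun i => xstar i + e i, fun i => ⟨by linarith [he0 i], by linarith [her i]⟩, ?_⟩
  intro b hb0 hb K hK τ hτ d hd x hx A xp
  have hμδ : ∀ i, h4.μ i ≤ h1.δt i := fun i => (h4.hμ i).2.le
  have hxμ : ∀ i, x i ≤ h4.μ i := fun i => by linarith [(hx i).2, her i]
  have hxt : ∀ i, x i ∈ Set.Icc 0 (h1.δt i) := fun i => ⟨(hx i).1, (hxμ i).trans (hμδ i)⟩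
  have hst : ∀ i, xstar i ∈ Set.Icc 0 (h1.δt i) := fun i =>
    ⟨(hxstar i).1.le, (hxstar i).2.le.trans (hμδ i)⟩
  have hsub : ∀ i, Set.Icc 0 (h1.δt i) ⊆ Set.Icc 0 (h1.δ i) := fun i =>
    Set.Icc_subset_Icc_right (h1.hδt i).2
  have hxS : x ∈ stateSet N.a := fun i =>
    Set.Icc_subset_Icc_right (h1.hδ i).2 (hsub i (hxt i))
  have hfb := feedback_bounds xstar x hb hK hτ
  set v := feedback vstar b K τ xstar x
  have hv0 : ∀ i, 0 ≤ v i := fun i => (hb0 i).trans (hfb i).1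
  have hxp : ∀ i, xp i = x i + v i - N.f i d (x i) + ∑ j, N.p j i * N.f j d (x j) :=
    h4.update_eq hd hxS hxμ hv0 fun i => (hfb i).2.1.trans (hvstar i).le
  have hA : ∀ (y : Fin n → ℝ) (i : Fin n),
      A.mulVec y i = (1 - h1.L i) * y i + ∑ j, N.p j i * (h1.G j * y j) := fun y i =>
    one_add_transpose_mul_diagonal_sub_diagonal_mulVec N.p h1.G h1.L y i
  have hA0 : ∀ (y : Fin n → ℝ) (i : Fin n), 0 ≤ A.mulVec (posVec y) i := fun y i => by
    rw [hA]
    refine add_nonneg (mul_nonneg (sub_nonneg.2 (h1.hL i).2.le) (le_max_left _ _))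
      (Finset.sum_nonneg fun j _ => mul_nonneg (N.hp_nonneg j i)
        (mul_nonneg (h1.hG j).1.le (le_max_left _ _)))
  have hinflow : ∀ (y z : Fin n → ℝ), (∀ j, y j ∈ Set.Icc 0 (h1.δt j)) →
      (∀ j, z j ∈ Set.Icc 0 (h1.δt j)) → ∀ i,
      z i - y i - (N.f i d (z i) - N.f i d (y i))
        + (∑ j, N.p j i * N.f j d (z j) - ∑ j, N.p j i * N.f j d (y j))
        ≤ A.mulVec (posVec (z - y)) i := fun y z hy hz i => by
    rw [hA, ← Finset.sum_sub_distrib]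
    refine add_le_add (h1.sub_sub_sub_le_mul_max hd (hy i) (hz i))
      (Finset.sum_le_sum fun j _ => ?_)
    rw [← mul_sub]
    exact mul_le_mul_of_nonneg_left
      (h1.sub_le_mul_max hd (hsub j (hy j)) (hsub j (hz j))) (N.hp_nonneg j i)
  have hupper : ∀ i, posVec (xp - xstar) i ≤ A.mulVec (posVec (x - xstar)) i := fun i => by
    refine max_le (hA0 _ i) ?_
    rw [Pi.sub_apply, hxp]
    linarith [hinflow xstar x hst hxt i, heq d hd i, (hfb i).2.1]
  have hlower : ∀ i, posVec (xstar - xp) i ≤ A.mulVec (posVec (xstar - x)) i +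
      (Matrix.diagonal (vstar - b) * (τ⁻¹ • K)).mulVec (posVec (x - xstar)) i := fun i => by
    have hK' : (Matrix.diagonal (vstar - b) * (τ⁻¹ • K)).mulVec (posVec (x - xstar)) i
        = (vstar i - b i) * (τ⁻¹ * ∑ j, K i j * max 0 (x j - xstar j)) := by
      rw [← Matrix.mulVec_mulVec, Matrix.mulVec_diagonal, Matrix.smul_mulVec]
      rfl
    rw [hK']
    refine max_le ?_ ?_
    · linarith [hA0 (xstar - x) i, (hfb i).2.1, (hfb i).2.2]
    · rw [Pi.sub_apply, hxp]
      linarith [hinflow x xstar hxt hst i, heq d hd i, (hfb i).2.2]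
  refine ⟨fun i => ⟨?_, ?_⟩, hupper, hlower⟩
  · have hsum : 0 ≤ ∑ j, N.p j i * N.f j d (x j) := Finset.sum_nonneg fun j _ =>
      mul_nonneg (N.hp_nonneg j i) (N.hf_nonneg j d hd _ (hxS j))
    rw [hxp]
    linarith [N.hf_le i d hd _ (hxS i), hv0 i]
  · have hpos : ∀ j, posVec (x - xstar) j ≤ e j := fun j =>
      max_le (he0 j).le (by rw [Pi.sub_apply]; linarith [(hx j).2])
    have hbound : A.mulVec (posVec (x - xstar)) i ≤
        (1 - h1.L i) * e i + ∑ j, N.p j i * h1.G j * e j := by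
      rw [hA]
      refine add_le_add
        (mul_le_mul_of_nonneg_left (hpos i) (sub_nonneg.2 (h1.hL i).2.le))
        (Finset.sum_le_sum fun j _ => ?_)
      rw [← mul_assoc]
      exact mul_le_mul_of_nonneg_left (hpos j)
        (mul_nonneg (N.hp_nonneg j i) (h1.hG j).1.le)
    have hmax : xp i - xstar i ≤ posVec (xp - xstar) i := le_max_right _ _
    linarith [hupper i, hesum i]
end

section
/- Consider the uncertain discrete-time network model under assumptions (H1), (H2), (H3), (H4). Assume the existence of a point x* ∈ S with x_i* ∈ (0,μ_i) for all i and a vector v* ∈ ℝ₊ⁿ with v_i* < v_i^max for all i, satisfying f_i(d,x_i*) = v_i* + Σ_{j=1}^n p_{j,i} f_j(d,x_j*) for all i and all d ∈ D. Then for every b ∈ ℝ₊ⁿ with b ≤ v*, every non-negative matrix K ∈ ℝ₊^{n×n} and every τ > 0, there exists a constant M > 0 (depending on b, K and τ) such that for all x ∈ S and d ∈ D, |x⁺ − x*| ≤ M |x − x*|, where x⁺ is the network update with the inflow v given by the feedback law (3.3) and |·| is the Euclidean norm. -/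
open Matrix

theorem abs_le_euclNorm {n : ℕ} (x : Fin n → ℝ) (i : Fin n) : |x i| ≤ euclNorm x :=
  Real.abs_le_sqrt
    (Finset.single_le_sum (f := fun j => x j ^ 2) (fun _ _ => sq_nonneg _) (Finset.mem_univ i))

theorem euclNorm_nonneg {n : ℕ} (x : Fin n → ℝ) : 0 ≤ euclNorm x :=
  Real.sqrt_nonneg _

theorem euclNorm_le_sum_abs {n : ℕ} (x : Fin n → ℝ) : euclNorm x ≤ ∑ i, |x i| := by
  refine Real.sqrt_le_iff.2 ⟨Finset.sum_nonneg fun i _ => abs_nonneg _, ?_⟩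
  simpa only [sq_abs] using
    Finset.sum_sq_le_sq_sum_of_nonneg (s := Finset.univ) (f := fun i => |x i|)
      fun i _ => abs_nonneg _

theorem one_sub_max_mem_Icc {t : ℝ} (ht : 0 ≤ t) :
    0 ≤ 1 - max 0 (1 - t) ∧ 1 - max 0 (1 - t) ≤ 1 ∧ 1 - max 0 (1 - t) ≤ t := by
  have h₁ : max 0 (1 - t) ≤ 1 := max_le zero_le_one (by linarith)
  have h₂ := le_max_left 0 (1 - t)
  have h₃ := le_max_right 0 (1 - t)
  exact ⟨by linarith, by linarith, by linarith⟩

section Feedback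

variable {n : ℕ} {vstar b : Fin n → ℝ} {K : Matrix (Fin n) (Fin n) ℝ} {τ : ℝ}

theorem feedback_gain_nonneg (hK : ∀ i j, 0 ≤ K i j) (hτ : 0 < τ) (xstar x : Fin n → ℝ)
    (i : Fin n) : 0 ≤ τ⁻¹ * ∑ j, K i j * max 0 (x j - xstar j) :=
  mul_nonneg (inv_nonneg.2 hτ.le)
    (Finset.sum_nonneg fun j _ => mul_nonneg (hK i j) (le_max_left _ _))

theorem le_feedback (hb : ∀ i, b i ≤ vstar i) (hK : ∀ i j, 0 ≤ K i j) (hτ : 0 < τ)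
    (xstar x : Fin n → ℝ) (i : Fin n) : b i ≤ feedback vstar b K τ xstar x i := by
  have h := (one_sub_max_mem_Icc (feedback_gain_nonneg hK hτ xstar x i)).2.1
  have := mul_le_mul_of_nonneg_left h (sub_nonneg.2 (hb i))
  unfold feedback
  linarith

theorem feedback_le (hb : ∀ i, b i ≤ vstar i) (hK : ∀ i j, 0 ≤ K i j) (hτ : 0 < τ)
    (xstar x : Fin n → ℝ) (i : Fin n) : feedback vstar b K τ xstar x i ≤ vstar i := by
  have h := (one_sub_max_mem_Icc (feedback_gain_nonneg hK hτ xstar x i)).1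
  have := mul_nonneg (sub_nonneg.2 (hb i)) h
  unfold feedback
  linarith

theorem abs_feedback_sub_le (hb : ∀ i, b i ≤ vstar i) (hK : ∀ i j, 0 ≤ K i j) (hτ : 0 < τ)
    (xstar x : Fin n → ℝ) (i : Fin n) :
    |feedback vstar b K τ xstar x i - vstar i| ≤
      (vstar i - b i) * (τ⁻¹ * ∑ j, K i j) * euclNorm (x - xstar) := by
  have hbi := sub_nonneg.2 (hb i)
  rw [abs_of_nonpos (sub_nonpos.2 (feedback_le hb hK hτ xstar x i))]
  have h := (one_sub_max_mem_Icc (feedback_gain_nonneg hK hτ xstar x i)).2.2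
  have hsum : ∑ j, K i j * max 0 (x j - xstar j) ≤ (∑ j, K i j) * euclNorm (x - xstar) := by
    rw [Finset.sum_mul]
    refine Finset.sum_le_sum fun j _ => mul_le_mul_of_nonneg_left ?_ (hK i j)
    exact max_le (euclNorm_nonneg _) ((le_abs_self _).trans (abs_le_euclNorm (x - xstar) j))
  calc -(feedback vstar b K τ xstar x i - vstar i)
      = (vstar i - b i) * (1 - max 0 (1 - τ⁻¹ * ∑ j, K i j * max 0 (x j - xstar j))) := by
        unfold feedback; ring
    _ ≤ (vstar i - b i) * (τ⁻¹ * ∑ j, K i j * max 0 (x j - xstar j)) :=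
        mul_le_mul_of_nonneg_left h hbi
    _ ≤ (vstar i - b i) * (τ⁻¹ * ((∑ j, K i j) * euclNorm (x - xstar))) := by gcongr
    _ = _ := by ring

end Feedback

section Update

variable {n l : ℕ} {N : Network n l} {d : Fin l → ℝ} {x v xstar vstar : Fin n → ℝ}

theorem Network.update_eq_of_uncongested (hd : d ∈ N.D) (hx : x ∈ stateSet N.a)
    (hv : ∀ j, 0 ≤ v j)
    (hsupply : ∀ i, v i + ∑ j, N.p j i * N.f j d (x j) ≤ N.g i d x) (i : Fin n) :
    N.update d x v i = x i + v i - N.f i d (x i) + ∑ j, N.p j i * N.f j d (x j) := by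
  have h := N.h28 d hd x hx v hv hsupply
  simp [Network.update, h]

/-- Near an uncongested equilibrium the update error is controlled by the errors in the state,
the inflow and the demands. -/
theorem Network.abs_update_sub_le_of_uncongested (hd : d ∈ N.D) (hx : x ∈ stateSet N.a)
    (hv : ∀ j, 0 ≤ v j)
    (hsupply : ∀ i, v i + ∑ j, N.p j i * N.f j d (x j) ≤ N.g i d x)
    (heq : ∀ i, N.f i d (xstar i) = vstar i + ∑ j, N.p j i * N.f j d (xstar j))
    {E : ℝ} (hE : ∀ i, |x i - xstar i| ≤ E)
    (hf : ∀ i, |N.f i d (x i) - N.f i d (xstar i)| ≤ E) (i : Fin n) :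
    |N.update d x v i - xstar i| ≤ (2 + ∑ j, N.p j i) * E + |v i - vstar i| := by
  have hsum : |∑ j, N.p j i * (N.f j d (x j) - N.f j d (xstar j))| ≤ (∑ j, N.p j i) * E := by
    rw [Finset.sum_mul]
    refine (Finset.abs_sum_le_sum_abs _ _).trans (Finset.sum_le_sum fun j _ => ?_)
    rw [abs_mul, abs_of_nonneg (N.hp_nonneg j i)]
    exact mul_le_mul_of_nonneg_left (hf j) (N.hp_nonneg j i)
  have hdecomp : N.update d x v i - xstar i = (x i - xstar i) + (v i - vstar i)
      - (N.f i d (x i) - N.f i d (xstar i))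
      + ∑ j, N.p j i * (N.f j d (x j) - N.f j d (xstar j)) := by
    rw [N.update_eq_of_uncongested hd hx hv hsupply]
    simp only [mul_sub, Finset.sum_sub_distrib]
    linarith [heq i]
  rw [hdecomp]
  have hxi := abs_le.1 (hE i)
  have hfi := abs_le.1 (hf i)
  have hs := abs_le.1 hsum
  have hvi := abs_le.1 (le_refl |v i - vstar i|)
  exact abs_le.2 ⟨by linarith [hxi.1, hfi.2, hs.1, hvi.1], by linarith [hxi.2, hfi.1, hs.2, hvi.2]⟩

/-- The update error is bounded on the state set, uniformly in the disturbance. -/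
theorem Network.abs_update_sub_le (hd : d ∈ N.D) (hx : x ∈ stateSet N.a)
    (hxstar : xstar ∈ stateSet N.a) (hv : ∀ j, 0 ≤ v j) (hvle : ∀ j, v j ≤ vstar j)
    (i : Fin n) :
    |N.update d x v i - xstar i| ≤ 2 * N.a i + vstar i + ∑ j, N.p j i * N.a j := by
  have hs : ∀ j, 0 ≤ N.s j d x v * N.f j d (x j) ∧ N.s j d x v * N.f j d (x j) ≤ N.a j := by
    intro j
    have hf0 := N.hf_nonneg j d hd _ (hx j)
    have hs01 := N.hs01 j d hd x hx v hv
    exact ⟨mul_nonneg hs01.1 hf0, (mul_le_of_le_one_left hf0 hs01.2).trans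
      ((N.hf_le j d hd _ (hx j)).trans (hx j).2)⟩
  have hw01 := N.hw01 i d hd x hx v hv
  have hw0 := mul_nonneg hw01.1 (hv i)
  have hw1 := (mul_le_of_le_one_left (hv i) hw01.2).trans (hvle i)
  have hsum0 : 0 ≤ ∑ j, N.p j i * (N.s j d x v * N.f j d (x j)) :=
    Finset.sum_nonneg fun j _ => mul_nonneg (N.hp_nonneg j i) (hs j).1
  have hsum1 : ∑ j, N.p j i * (N.s j d x v * N.f j d (x j)) ≤ ∑ j, N.p j i * N.a j :=
    Finset.sum_le_sum fun j _ => mul_le_mul_of_nonneg_left (hs j).2 (N.hp_nonneg j i)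
  unfold Network.update
  exact abs_le.2
    ⟨by linarith [(hx i).1, (hxstar i).2, (hs i).2, N.ha i],
      by linarith [(hx i).2, (hxstar i).1, (hs i).1, N.ha i]⟩

end Update

/-- **Lemma 3.5.** Under (H1), (H2), (H3), (H4), assume the existence of an
uncongested equilibrium point `x*` with `x* i ∈ (0, μ i)` and `v* i ∈ [0, vmax i)`
satisfying (3.1). Then for every `b ∈ ℝ₊ⁿ` with `b ≤ v*`, every non-negative
matrix `K` and every `τ > 0`, there exists a constant `M > 0` such that
`|x⁺ − x*| ≤ M |x − x*|` for all `x ∈ S` and `d ∈ D`, where `x⁺` is the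
closed-loop update under the feedback law (3.3) and `|·|` the Euclidean norm. -/
theorem stmt10 {n l : ℕ} (hn : 1 ≤ n) (N : Network n l)
    (h1 : H1 N) (h2 : N.H2) (h3 : H3 N) (h4 : H4 N h1.δt h3.vmax)
    (xstar vstar : Fin n → ℝ)
    (hxstar : ∀ i, xstar i ∈ Set.Ioo 0 (h4.μ i))
    (hvstar_nonneg : ∀ i, 0 ≤ vstar i)
    (hvstar : ∀ i, vstar i < h3.vmax i)
    (heq : ∀ d ∈ N.D, ∀ i,
      N.f i d (xstar i) = vstar i + ∑ j, N.p j i * N.f j d (xstar j)) :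
    ∀ b : Fin n → ℝ, (∀ i, 0 ≤ b i) → (∀ i, b i ≤ vstar i) →
    ∀ K : Matrix (Fin n) (Fin n) ℝ, (∀ i j, 0 ≤ K i j) →
    ∀ τ : ℝ, 0 < τ →
    ∃ M > (0 : ℝ), ∀ d ∈ N.D, ∀ x ∈ stateSet N.a,
      euclNorm (N.update d x (feedback vstar b K τ xstar x) - xstar) ≤
        M * euclNorm (x - xstar) := by
  intro b hb0 hb K hK τ hτ
  have hμδ : ∀ i, h4.μ i < h1.δ i := fun i => (h4.hμ i).2.trans_le (h1.hδt i).2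
  have hxstar_mem : xstar ∈ stateSet N.a := fun i =>
    ⟨(hxstar i).1.le, ((hxstar i).2.trans (hμδ i)).le.trans (h1.hδ i).2⟩
  set R : ℝ := ∑ j, (h4.μ j - xstar j)⁻¹
  have hgap : ∀ j, 0 < h4.μ j - xstar j := fun j => sub_pos.2 (hxstar j).2
  have hR0 : 0 ≤ R := Finset.sum_nonneg fun j _ => (inv_pos.2 (hgap j)).le
  set A : Fin n → ℝ := fun i => 2 + ∑ j, N.p j i + (vstar i - b i) * (τ⁻¹ * ∑ j, K i j) with hA
  set B : Fin n → ℝ := fun i => 2 * N.a i + vstar i + ∑ j, N.p j i * N.a j with hB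
  have hA0 : ∀ i, 0 ≤ A i := fun i => by
    have h₁ : 0 ≤ ∑ j, N.p j i := Finset.sum_nonneg fun j _ => N.hp_nonneg j i
    have h₂ : 0 ≤ (vstar i - b i) * (τ⁻¹ * ∑ j, K i j) :=
      mul_nonneg (sub_nonneg.2 (hb i))
        (mul_nonneg (inv_nonneg.2 hτ.le) (Finset.sum_nonneg fun j _ => hK i j))
    simp only [hA]
    linarith
  have hB0 : ∀ i, 0 ≤ B i := fun i => by
    have h₁ : 0 ≤ ∑ j, N.p j i * N.a j :=
      Finset.sum_nonneg fun j _ => mul_nonneg (N.hp_nonneg j i) (N.ha j).le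
    simp only [hB]
    linarith [N.ha i, hvstar_nonneg i]
  have hAB0 : ∀ i, 0 ≤ A i + B i * R := fun i => add_nonneg (hA0 i) (mul_nonneg (hB0 i) hR0)
  refine ⟨∑ i, (A i + B i * R) + 1,
    add_pos_of_nonneg_of_pos (Finset.sum_nonneg fun i _ => hAB0 i) one_pos, ?_⟩
  intro d hd x hx
  set E := euclNorm (x - xstar)
  have hE0 : 0 ≤ E := euclNorm_nonneg _
  have hE : ∀ i, |x i - xstar i| ≤ E := abs_le_euclNorm (x - xstar)
  set v := feedback vstar b K τ xstar x
  have hv0 : ∀ j, 0 ≤ v j := fun j => (hb0 j).trans (le_feedback hb hK hτ xstar x j)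
  have hvle : ∀ j, v j ≤ vstar j := feedback_le hb hK hτ xstar x
  have hcoord : ∀ i, |N.update d x v i - xstar i| ≤ (A i + B i * R) * E := by
    intro i
    by_cases hxμ : ∀ j, x j ≤ h4.μ j
    · have hsupply : ∀ i, v i + ∑ j, N.p j i * N.f j d (x j) ≤ N.g i d x := fun i => by
        linarith [h4.hsupply i d hd x hx hxμ, hvle i, hvstar i]
      have hf : ∀ i, |N.f i d (x i) - N.f i d (xstar i)| ≤ E := fun i =>
        (h1.hlip_up i d hd (xstar i) ⟨(hxstar i).1.le, ((hxstar i).2.trans (hμδ i)).le⟩ (x i)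
          ⟨(hx i).1, (hxμ i).trans (hμδ i).le⟩).trans
          ((mul_le_of_le_one_left (abs_nonneg _) (h1.hG i).2).trans (hE i))
      calc |N.update d x v i - xstar i|
          ≤ (2 + ∑ j, N.p j i) * E + |v i - vstar i| :=
            N.abs_update_sub_le_of_uncongested hd hx hv0 hsupply (heq d hd) hE hf i
        _ ≤ (2 + ∑ j, N.p j i) * E + (vstar i - b i) * (τ⁻¹ * ∑ j, K i j) * E := by
            gcongr
            exact abs_feedback_sub_le hb hK hτ xstar x i
        _ = A i * E := by simp only [hA]; ring
        _ ≤ (A i + B i * R) * E := by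
            gcongr
            exact le_add_of_nonneg_right (mul_nonneg (hB0 i) hR0)
    · push Not at hxμ
      obtain ⟨k, hk⟩ := hxμ
      have hkE : h4.μ k - xstar k ≤ E := by linarith [le_abs_self (x k - xstar k), hE k]
      have hRE : 1 ≤ R * E :=
        calc 1 = (h4.μ k - xstar k)⁻¹ * (h4.μ k - xstar k) :=
              (inv_mul_cancel₀ (hgap k).ne').symm
          _ ≤ R * E := mul_le_mul
              (Finset.single_le_sum (f := fun j => (h4.μ j - xstar j)⁻¹)
                (fun j _ => (inv_pos.2 (hgap j)).le) (Finset.mem_univ k))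
              hkE (hgap k).le hR0
      calc |N.update d x v i - xstar i|
          ≤ B i := N.abs_update_sub_le hd hx hxstar_mem hv0 hvle i
        _ ≤ B i * (R * E) := le_mul_of_one_le_right (hB0 i) hRE
        _ = B i * R * E := by ring
        _ ≤ (A i + B i * R) * E := by
            gcongr
            exact le_add_of_nonneg_left (hA0 i)
  calc euclNorm (N.update d x v - xstar)
      ≤ ∑ i, |(N.update d x v - xstar) i| := euclNorm_le_sum_abs _
    _ ≤ ∑ i, (A i + B i * R) * E := Finset.sum_le_sum fun i _ => hcoord i
    _ = (∑ i, (A i + B i * R)) * E := (Finset.sum_mul _ _ _).symm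
    _ ≤ (∑ i, (A i + B i * R) + 1) * E := by
        gcongr
        exact le_add_of_nonneg_right zero_le_one
end
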